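/- (Theorem 4) Let 1 ≤ m ≤ n. Let A be an m×(n−1) spin matrix with guard qubits a_{i,−1} = +1 and a_{i,n−1} = −1, let B be an (m−1)×n spin matrix with guard qubits b_{−1,j} = +1 and b_{m−1,j} = −1, and let S = (s_{i,j}) be an m×n spin matrix. Define Δa_{i,j} = a_{i,j−1} − a_{i,j} and Δb_{i,j} = b_{i−1,j} − b_{i,j} for 0 ≤ i ≤ m−1 and 0 ≤ j ≤ n−1, and set H_e^{mn}(A,B,S) = (1/2)·Σ_{i,j} (Δa_{i,j})^2 + (1/2)·Σ_{i,j} (Δb_{i,j})^2 + Σ_{i,j} ((s_{i,j}+1) − Δa_{i,j})^2 + Σ_{i,j} (s_{i,j}+1)·(2 − Δb_{i,j}). Then H_e^{mn}(A,B,S) ≥ 2m + 2n, and H_e^{mn}(A,B,S) = 2m + 2n if and only if A, B, and S satisfy the row domain-wall condition, the column domain-wall condition, the dual-permutation condition, and the one-hot permutation condition. -/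

import Mathlib

/-- Guard-extended row of the spin matrix `A` (rows of length `n-1`, guard qubits
`a_{i,-1} = +1` at shifted index `0` and `a_{i,n-1} = -1` at shifted index `n`). -/
def gA (n : ℕ) (A : ℕ → ℕ → ℤ) (i j : ℕ) : ℤ :=
  if j = 0 then 1 else if j < n then A i (j - 1) else -1

/-- `Δa_{i,j} = a_{i,j-1} - a_{i,j}` computed on the guard-extended rows of `A`. -/
def dA (n : ℕ) (A : ℕ → ℕ → ℤ) (i j : ℕ) : ℤ := gA n A i j - gA n A i (j + 1)

/-- Guard-extended column of the spin matrix `B` (columns of length `m-1`, guard qubits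
`b_{-1,j} = +1` at shifted index `0` and `b_{m-1,j} = -1` at shifted index `m`). -/
def gB (m : ℕ) (B : ℕ → ℕ → ℤ) (i j : ℕ) : ℤ :=
  if i = 0 then 1 else if i < m then B (i - 1) j else -1

/-- `Δb_{i,j} = b_{i-1,j} - b_{i,j}` computed on the guard-extended columns of `B`. -/
def dB (m : ℕ) (B : ℕ → ℕ → ℤ) (i j : ℕ) : ℤ := gB m B i j - gB m B (i + 1) j

/-- Row domain-wall condition: every guard-extended row of the `m × (n-1)` spin matrix `A`
is a spin domain-wall vector. -/
def RowDW (m n : ℕ) (A : ℕ → ℕ → ℤ) : Prop :=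
  ∀ i < m, ∃ t ≤ n - 1, ∀ j < n - 1, (j < t → A i j = 1) ∧ (t ≤ j → A i j = -1)

/-- Column domain-wall condition: every guard-extended column of the `(m-1) × n` spin
matrix `B` is a spin domain-wall vector. -/
def ColDW (m n : ℕ) (B : ℕ → ℕ → ℤ) : Prop :=
  ∀ j < n, ∃ t ≤ m - 1, ∀ i < m - 1, (i < t → B i j = 1) ∧ (t ≤ i → B i j = -1)

/-- The extended dual-matrix domain-wall Ising Hamiltonian for partial permutations:
`H_eᵐⁿ(A,B,S) = ½ ΣΣ (Δa)² + ½ ΣΣ (Δb)² + ΣΣ ((s+1) - Δa)² + ΣΣ (s+1)·(2 - Δb)`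
over `0 ≤ i ≤ m-1` and `0 ≤ j ≤ n-1`. -/
def He (m n : ℕ) (A B S : ℕ → ℕ → ℤ) : ℚ :=
  (1 / 2 : ℚ) * ∑ i ∈ Finset.range m, ∑ j ∈ Finset.range n, (dA n A i j : ℚ) ^ 2 +
  (1 / 2 : ℚ) * ∑ i ∈ Finset.range m, ∑ j ∈ Finset.range n, (dB m B i j : ℚ) ^ 2 +
  ∑ i ∈ Finset.range m, ∑ j ∈ Finset.range n,
    (((S i j : ℚ) + 1) - (dA n A i j : ℚ)) ^ 2 +
  ∑ i ∈ Finset.range m, ∑ j ∈ Finset.range n,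
    ((S i j : ℚ) + 1) * (2 - (dB m B i j : ℚ))

/-- Dual-permutation condition (spin version): for all `i < m` and `j < n`, if
`Δa_{i,j} = 2` then `Δb_{i,j} = 2`. -/
def DualPerm (m n : ℕ) (A B : ℕ → ℕ → ℤ) : Prop :=
  ∀ i < m, ∀ j < n, dA n A i j = 2 → dB m B i j = 2

/-- One-hot permutation condition (spin version): `s_{i,j} + 1 = Δa_{i,j}` for all
`i < m`, `j < n`. -/
def OneHotPerm (m n : ℕ) (A S : ℕ → ℕ → ℤ) : Prop :=
  ∀ i < m, ∀ j < n, S i j + 1 = dA n A i j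

/-- A vector `f` of length `k - 1` extended by the guards `+1` (index `0`) and `-1` (index `k`). -/
def guardExt (k : ℕ) (f : ℕ → ℤ) (j : ℕ) : ℤ :=
  if j = 0 then 1 else if j < k then f (j - 1) else -1

lemma guardExt_eq (k : ℕ) (f : ℕ → ℤ) (hf : ∀ j < k - 1, f j = -1 ∨ f j = 1) (j : ℕ) :
    guardExt k f j = -1 ∨ guardExt k f j = 1 := by
  unfold guardExt
  split_ifs with h0 h1
  · exact Or.inr rfl
  · exact hf _ (by omega)
  · exact Or.inl rfl

lemma guardExt_diff_eq (k : ℕ) (f : ℕ → ℤ) (hf : ∀ j < k - 1, f j = -1 ∨ f j = 1) (j : ℕ) :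
    guardExt k f j - guardExt k f (j + 1) = -2 ∨ guardExt k f j - guardExt k f (j + 1) = 0 ∨
      guardExt k f j - guardExt k f (j + 1) = 2 := by
  have h1 := guardExt_eq k f hf j
  have h2 := guardExt_eq k f hf (j + 1)
  omega

lemma sum_guardExt_diff (k : ℕ) (hk : 1 ≤ k) (f : ℕ → ℤ) :
    ∑ j ∈ Finset.range k, (guardExt k f j - guardExt k f (j + 1)) = 2 := by
  rw [Finset.sum_range_sub']
  simp [guardExt, show k ≠ 0 by omega]

/-- A spin vector is a domain-wall vector iff its guard extension is nonincreasing. -/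
lemma domainWall_iff_guardExt_diff_nonneg (k : ℕ) (hk : 1 ≤ k) (f : ℕ → ℤ)
    (hf : ∀ j < k - 1, f j = -1 ∨ f j = 1) :
    (∃ t ≤ k - 1, ∀ j < k - 1, (j < t → f j = 1) ∧ (t ≤ j → f j = -1)) ↔
      ∀ j < k, 0 ≤ guardExt k f j - guardExt k f (j + 1) := by
  constructor
  · rintro ⟨t, -, h⟩ j hj
    have hlast := guardExt_eq k f hf j
    rcases Nat.eq_zero_or_pos j with rfl | hj0
    · have := guardExt_eq k f hf (0 + 1)
      have h0 : guardExt k f 0 = 1 := by simp [guardExt]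
      omega
    · by_cases hjk : j + 1 < k
      · have e1 : guardExt k f j = f (j - 1) := by simp [guardExt, hj, hj0.ne']
        have e2 : guardExt k f (j + 1) = f j := by simp [guardExt, hjk]
        have h1 := h (j - 1) (by omega)
        have h2 := h j (by omega)
        rw [e1, e2]
        by_cases ht : j - 1 < t
        · have := h1.1 ht
          have := hf j (by omega)
          omega
        · have := h1.2 (by omega)
          have := h2.2 (by omega)
          omega
      · have e2 : guardExt k f (j + 1) = -1 := by simp [guardExt, hjk]
        omega
  · intro h
    have hex : ∃ t, guardExt k f (t + 1) = -1 :=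
      ⟨k - 1, by simp [guardExt, show ¬ (k - 1 + 1 < k) by omega]⟩
    have hstep (j : ℕ) (hj : j < k - 1) : guardExt k f (j + 1) = f j := by
      simp [guardExt, show j + 1 < k by omega]
    refine ⟨Nat.find hex, Nat.find_min' hex
      (by simp [guardExt, show ¬ (k - 1 + 1 < k) by omega]),
      fun j hj => ⟨fun hlt => ?_, fun hle => ?_⟩⟩
    · have := Nat.find_min hex hlt
      rw [hstep j hj] at this
      exact (hf j hj).resolve_left this
    · have key : ∀ i, Nat.find hex ≤ i → i < k → guardExt k f (i + 1) = -1 := by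
        intro i hi
        induction i, hi using Nat.le_induction with
        | base => exact fun _ => Nat.find_spec hex
        | succ i _ ih =>
          intro hik
          have h1 := ih (by omega)
          have h2 := h (i + 1) hik
          have h3 := guardExt_eq k f hf (i + 1 + 1)
          omega
      rw [← hstep j hj]
      exact key j hle (by omega)

lemma dA_eq_guardExt (n : ℕ) (A : ℕ → ℕ → ℤ) (i j : ℕ) :
    dA n A i j = guardExt n (A i) j - guardExt n (A i) (j + 1) := rfl

lemma dB_eq_guardExt (m : ℕ) (B : ℕ → ℕ → ℤ) (i j : ℕ) :
    dB m B i j = guardExt m (fun i => B i j) i - guardExt m (fun i => B i j) (i + 1) := rfl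

/-- The excess of the energy of one cell over `Δa + Δb`. -/
def cellExcess (a b s : ℚ) : ℚ :=
  (1 / 2 * a ^ 2 - a) + (1 / 2 * b ^ 2 - b) + (s + 1 - a) ^ 2 + (s + 1) * (2 - b)

lemma cellExcess_nonneg_and_eq_zero_iff {a b s : ℤ} (ha : a = -2 ∨ a = 0 ∨ a = 2)
    (hb : b = -2 ∨ b = 0 ∨ b = 2) (hs : s = -1 ∨ s = 1) :
    0 ≤ cellExcess a b s ∧
      (cellExcess a b s = 0 ↔ 0 ≤ a ∧ 0 ≤ b ∧ (a = 2 → b = 2) ∧ s + 1 = a) := by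
  rcases ha with rfl | rfl | rfl <;> rcases hb with rfl | rfl | rfl <;>
    rcases hs with rfl | rfl <;> norm_num [cellExcess]

lemma He_eq_add_sum_cellExcess (m n : ℕ) (hm : 1 ≤ m) (hn : 1 ≤ n) (A B S : ℕ → ℕ → ℤ) :
    He m n A B S = 2 * m + 2 * n + ∑ i ∈ Finset.range m, ∑ j ∈ Finset.range n,
      cellExcess (dA n A i j) (dB m B i j) (S i j) := by
  have h1 : ∑ i ∈ Finset.range m, ∑ j ∈ Finset.range n, (dA n A i j : ℚ) = 2 * m := by
    have : ∑ i ∈ Finset.range m, ∑ j ∈ Finset.range n, dA n A i j = 2 * m := by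
      simp only [dA_eq_guardExt, sum_guardExt_diff n hn, Finset.sum_const, Finset.card_range,
        nsmul_eq_mul, mul_comm]
    exact_mod_cast this
  have h2 : ∑ i ∈ Finset.range m, ∑ j ∈ Finset.range n, (dB m B i j : ℚ) = 2 * n := by
    have : ∑ i ∈ Finset.range m, ∑ j ∈ Finset.range n, dB m B i j = 2 * n := by
      rw [Finset.sum_comm]
      simp only [dB_eq_guardExt, sum_guardExt_diff m hm, Finset.sum_const, Finset.card_range,
        nsmul_eq_mul, mul_comm]
    exact_mod_cast this
  simp only [cellExcess, Finset.sum_add_distrib, Finset.sum_sub_distrib, ← Finset.mul_sum, h1, h2,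
    He]
  ring

/-- Theorem 4: `H_eᵐⁿ(A,B,S) ≥ 2m + 2n`, with equality iff `A`, `B`, and `S` satisfy the
row domain-wall, column domain-wall, dual-permutation, and one-hot permutation
conditions. -/
theorem He_min_iff_conditions (m n : ℕ) (hm : 1 ≤ m) (hmn : m ≤ n)
    (A B S : ℕ → ℕ → ℤ)
    (hA : ∀ i < m, ∀ j < n - 1, A i j = -1 ∨ A i j = 1)
    (hB : ∀ i < m - 1, ∀ j < n, B i j = -1 ∨ B i j = 1)
    (hS : ∀ i < m, ∀ j < n, S i j = -1 ∨ S i j = 1) :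
    (2 * m + 2 * n : ℚ) ≤ He m n A B S ∧
    (He m n A B S = 2 * m + 2 * n ↔
      RowDW m n A ∧ ColDW m n B ∧ DualPerm m n A B ∧ OneHotPerm m n A S) := by
  have hn : 1 ≤ n := hm.trans hmn
  have hcell : ∀ i < m, ∀ j < n, _ := fun i hi j hj =>
    cellExcess_nonneg_and_eq_zero_iff (guardExt_diff_eq n (A i) (hA i hi) j)
      (guardExt_diff_eq m (fun i => B i j) (fun i hi => hB i hi j hj) i) (hS i hi j hj)
  simp only [← dA_eq_guardExt, ← dB_eq_guardExt] at hcell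
  have hrow : ∀ i ∈ Finset.range m, 0 ≤ ∑ j ∈ Finset.range n,
      cellExcess (dA n A i j) (dB m B i j) (S i j) := fun i hi =>
    Finset.sum_nonneg fun j hj => (hcell i (Finset.mem_range.1 hi) j (Finset.mem_range.1 hj)).1
  have hzero : (∑ i ∈ Finset.range m, ∑ j ∈ Finset.range n,
      cellExcess (dA n A i j) (dB m B i j) (S i j) = 0) ↔
      ∀ i < m, ∀ j < n, 0 ≤ dA n A i j ∧ 0 ≤ dB m B i j ∧
        (dA n A i j = 2 → dB m B i j = 2) ∧ S i j + 1 = dA n A i j := by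
    rw [Finset.sum_eq_zero_iff_of_nonneg hrow]
    simp only [Finset.mem_range]
    refine forall₂_congr fun i hi => ?_
    rw [Finset.sum_eq_zero_iff_of_nonneg fun j hj => (hcell i hi j (Finset.mem_range.1 hj)).1]
    simp only [Finset.mem_range]
    exact forall₂_congr fun j hj => (hcell i hi j hj).2
  have hR : RowDW m n A ↔ ∀ i < m, ∀ j < n, 0 ≤ dA n A i j :=
    forall₂_congr fun i hi => domainWall_iff_guardExt_diff_nonneg n hn (A i) (hA i hi)
  have hC : ColDW m n B ↔ ∀ j < n, ∀ i < m, 0 ≤ dB m B i j :=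
    forall₂_congr fun j hj =>
      domainWall_iff_guardExt_diff_nonneg m hm (fun i => B i j) fun i hi => hB i hi j hj
  rw [He_eq_add_sum_cellExcess m n hm hn, add_eq_left, hzero, hR, hC]
  refine ⟨le_add_of_nonneg_right (Finset.sum_nonneg hrow), fun h => ?_, ?_⟩
  · exact ⟨fun i hi j hj => (h i hi j hj).1, fun j hj i hi => (h i hi j hj).2.1,
      fun i hi j hj => (h i hi j hj).2.2.1, fun i hi j hj => (h i hi j hj).2.2.2⟩
  · rintro ⟨h1, h2, h3, h4⟩ i hi j hj
    exact ⟨h1 i hi j hj, h2 j hj i hi, h3 i hi j hj, h4 i hi j hj⟩
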